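/- Let A and B be disjoint finite sets of ground equality literals over a first-order signature of function symbols such that A ∪ B is unsatisfiable in first-order logic with equality. Then there exists a ground sentence I such that: (i) I is a conjunction of Horn clauses whose atoms are equations between ground terms (a Horn clause being a disjunction of literals with at most one positive literal); (ii) every function symbol occurring in I occurs both in A and in B; (iii) A ⊨ I; and (iv) B ∪ {I} is unsatisfiable. -/

import Mathlib

open FirstOrder Language

universe u v

/-- Value of a ground term in a structure. -/
def gval {L : FirstOrder.Language.{u, v}} (M : Type) (str : L.Structure M)
    (t : L.Term Empty) : M :=
  letI := str
  t.realize Empty.elim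

/-- A function symbol (paired with its arity) occurs in a term. -/
inductive TFunc {L : FirstOrder.Language.{u, v}} {α : Type*} :
    (Σ n, L.Functions n) → L.Term α → Prop
  | head {k : ℕ} (f : L.Functions k) (ts : Fin k → L.Term α) : TFunc ⟨k, f⟩ (Term.func f ts)
  | arg {k : ℕ} (f : L.Functions k) (ts : Fin k → L.Term α) (i : Fin k) {g} :
      TFunc g (ts i) → TFunc g (Term.func f ts)

/-- A ground equality literal: `(true, s, t)` is the equation `s = t`,
`(false, s, t)` the disequation `s ≠ t`. -/
abbrev GLit (L : FirstOrder.Language.{u, v}) := Bool × L.Term Empty × L.Term Empty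

/-- Truth of a ground equality literal in a structure. -/
def LitHolds {L : FirstOrder.Language.{u, v}} (M : Type) (str : L.Structure M)
    (l : GLit L) : Prop :=
  if l.1 then gval M str l.2.1 = gval M str l.2.2
  else gval M str l.2.1 ≠ gval M str l.2.2

/-- A ground Horn clause whose atoms are equations between ground terms: a finite
set (list) of negated equations together with at most one positive equation. -/
abbrev HornClause (L : FirstOrder.Language.{u, v}) :=
  List (L.Term Empty × L.Term Empty) × Option (L.Term Empty × L.Term Empty)

/-- Truth of a Horn clause in a structure: some negated atom fails or the positive
atom (if any) holds; equivalently, if all the negated atoms hold then the positive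
atom holds (`False` if there is none). -/
def HornHolds {L : FirstOrder.Language.{u, v}} (M : Type) (str : L.Structure M)
    (c : HornClause L) : Prop :=
  (∀ p ∈ c.1, gval M str p.1 = gval M str p.2) →
    match c.2 with
    | some q => gval M str q.1 = gval M str q.2
    | none => False

/-- The function symbols occurring in a Horn clause. -/
def ClauseSymbols {L : FirstOrder.Language.{u, v}} (c : HornClause L) :
    Set (Σ n, L.Functions n) :=
  {g | (∃ p ∈ c.1, TFunc g p.1 ∨ TFunc g p.2) ∨
       (∃ q, c.2 = some q ∧ (TFunc g q.1 ∨ TFunc g q.2))}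

/-- The function symbols occurring in (the terms of) a set of ground literals. -/
def SymbolsOf {L : FirstOrder.Language.{u, v}} (A : Set (GLit L)) :
    Set (Σ n, L.Functions n) :=
  {g | ∃ l ∈ A, TFunc g l.2.1 ∨ TFunc g l.2.2}

section

variable {L : FirstOrder.Language.{u, v}}

theorem gval_func (M : Type) (str : L.Structure M) {k : ℕ} (f : L.Functions k)
    (ts : Fin k → L.Term Empty) :
    gval M str (Term.func f ts) = str.funMap f fun i => gval M str (ts i) :=
  rfl

/-- A ground term all of whose function symbols occur in every part `E b`. -/
def IsShared (E : Bool → Set (GLit L)) (t : L.Term Empty) : Prop :=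
  ∀ g, TFunc g t → ∀ b, g ∈ SymbolsOf (E b)

/-- Two congruences on ground terms, the one indexed by `b` generated by the equations of `E b`,
which exchange their equations between shared terms. -/
inductive SplitCongr (E : Bool → Set (GLit L)) : Bool → L.Term Empty → L.Term Empty → Prop
  | base {b s t} : (true, s, t) ∈ E b → SplitCongr E b s t
  | transfer {b s t} (b') : SplitCongr E b s t → IsShared E s → IsShared E t → SplitCongr E b' s t
  | refl {b} (t) : SplitCongr E b t t
  | symm {b s t} : SplitCongr E b s t → SplitCongr E b t s
  | trans {b s t r} : SplitCongr E b s t → SplitCongr E b t r → SplitCongr E b s r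
  | congr {b} {k : ℕ} (f : L.Functions k) {ss ts : Fin k → L.Term Empty} :
      (∀ i, SplitCongr E b (ss i) (ts i)) → SplitCongr E b (Term.func f ss) (Term.func f ts)

/-! ### Subterms -/

/-- The set of subterms of a term. -/
def subterms : L.Term Empty → Set (L.Term Empty)
  | .var x => {.var x}
  | .func f ts => insert (.func f ts) (⋃ i, subterms (ts i))

theorem self_mem_subterms (t : L.Term Empty) : t ∈ subterms t := by
  cases t <;> simp [subterms]

theorem countable_subterms (t : L.Term Empty) : (subterms t).Countable := by
  induction t with
  | var x => exact x.elim
  | func f ts ih => exact (Set.countable_iUnion ih).insert _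

theorem arg_mem_subterms {t : L.Term Empty} {k : ℕ} {f : L.Functions k}
    {ts : Fin k → L.Term Empty} (h : Term.func f ts ∈ subterms t) (i : Fin k) :
    ts i ∈ subterms t := by
  induction t with
  | var x => exact x.elim
  | func g rs ih =>
    rcases h with h | h
    · cases h
      exact Or.inr (Set.mem_iUnion.2 ⟨i, self_mem_subterms _⟩)
    · obtain ⟨j, hj⟩ := Set.mem_iUnion.1 h
      exact Or.inr (Set.mem_iUnion.2 ⟨j, ih j hj⟩)

theorem TFunc.of_mem_subterms {s t : L.Term Empty} {g : Σ n, L.Functions n} (hg : TFunc g s)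
    (h : s ∈ subterms t) : TFunc g t := by
  induction t with
  | var x => exact x.elim
  | func f ts ih =>
    rcases h with h | h
    · exact h ▸ hg
    · obtain ⟨j, hj⟩ := Set.mem_iUnion.1 h
      exact .arg f ts j (ih j hj)

/-- The subterms of the terms occurring in a set of literals. -/
def termsOf (A : Set (GLit L)) : Set (L.Term Empty) :=
  ⋃ l ∈ A, subterms l.2.1 ∪ subterms l.2.2

theorem mem_termsOf {A : Set (GLit L)} {t : L.Term Empty} :
    t ∈ termsOf A ↔ ∃ l ∈ A, t ∈ subterms l.2.1 ∨ t ∈ subterms l.2.2 := by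
  simp [termsOf]

theorem countable_termsOf {A : Set (GLit L)} (hA : A.Countable) : (termsOf A).Countable :=
  hA.biUnion fun _ _ => (countable_subterms _).union (countable_subterms _)

theorem arg_mem_termsOf {A : Set (GLit L)} {k : ℕ} {f : L.Functions k}
    {ts : Fin k → L.Term Empty} (h : Term.func f ts ∈ termsOf A) (i : Fin k) :
    ts i ∈ termsOf A := by
  obtain ⟨l, hl, h⟩ := mem_termsOf.1 h
  exact mem_termsOf.2 ⟨l, hl, h.imp (arg_mem_subterms · i) (arg_mem_subterms · i)⟩

theorem mem_symbolsOf_of_mem_termsOf {A : Set (GLit L)} {t : L.Term Empty} (h : t ∈ termsOf A)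
    {g : Σ n, L.Functions n} (hg : TFunc g t) : g ∈ SymbolsOf A := by
  obtain ⟨l, hl, h⟩ := mem_termsOf.1 h
  exact ⟨l, hl, h.imp hg.of_mem_subterms hg.of_mem_subterms⟩

/-! ### Amalgamation -/

/-- The amalgam over the shared terms of the two congruences `SplitCongr E b`. -/
def amalgamSetoid (E : Bool → Set (GLit L)) : Setoid (Bool × L.Term Empty) where
  r x y := (x.1 = y.1 ∧ SplitCongr E x.1 x.2 y.2) ∨
    ∃ u, IsShared E u ∧ SplitCongr E x.1 x.2 u ∧ SplitCongr E y.1 u y.2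
  iseqv :=
    { refl := fun x => Or.inl ⟨rfl, .refl _⟩
      symm := by
        rintro ⟨b, s⟩ ⟨c, t⟩ (⟨h, h'⟩ | ⟨u, hu, h, h'⟩)
        · obtain rfl : b = c := h
          exact Or.inl ⟨rfl, h'.symm⟩
        · exact Or.inr ⟨u, hu, h'.symm, h.symm⟩
      trans := by
        rintro ⟨b, s⟩ ⟨c, t⟩ ⟨d, r⟩ (⟨h, h'⟩ | ⟨u, hu, h, h'⟩) (⟨k, k'⟩ | ⟨w, hw, k, k'⟩)
        · obtain rfl : b = c := h
          exact Or.inl ⟨k, h'.trans k'⟩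
        · obtain rfl : b = c := h
          exact Or.inr ⟨w, hw, h'.trans k, k'⟩
        · obtain rfl : c = d := k
          exact Or.inr ⟨u, hu, h, h'.trans k'⟩
        · exact Or.inr ⟨w, hw, h.trans (.transfer b (h'.trans k) hu hw), k'⟩ }

theorem amalgamSetoid_same {E : Bool → Set (GLit L)} {b : Bool} {s t : L.Term Empty} :
    amalgamSetoid E (b, s) (b, t) ↔ SplitCongr E b s t := by
  refine ⟨?_, fun h => Or.inl ⟨rfl, h⟩⟩
  rintro (⟨_, h⟩ | ⟨u, _, h, h'⟩)
  · exact h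
  · exact h.trans h'

theorem amalgamSetoid_func {E : Bool → Set (GLit L)} {b c : Bool} {k : ℕ} {f : L.Functions k}
    {ss ts : Fin k → L.Term Empty} (hb : ⟨k, f⟩ ∈ SymbolsOf (E b)) (hc : ⟨k, f⟩ ∈ SymbolsOf (E c))
    (h : ∀ i, amalgamSetoid E (b, ss i) (c, ts i)) :
    amalgamSetoid E (b, Term.func f ss) (c, Term.func f ts) := by
  by_cases hbc : b = c
  · subst hbc
    exact amalgamSetoid_same.2 (.congr f fun i => amalgamSetoid_same.1 (h i))
  · have h' : ∀ i, ∃ u, IsShared E u ∧ SplitCongr E b (ss i) u ∧ SplitCongr E c u (ts i) :=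
      fun i => (h i).resolve_left fun h => hbc h.1
    choose u hu h₁ h₂ using h'
    refine Or.inr ⟨Term.func f u, ?_, .congr f h₁, .congr f h₂⟩
    intro g hg a
    cases hg with
    | head =>
      rcases Bool.eq_or_eq_not a b with rfl | rfl
      · exact hb
      · rwa [Bool.eq_not.2 (Ne.symm hbc)] at hc
    | arg _ _ i hg => exact hu i g hg a

theorem exists_model_of_splitCongr (E : Bool → Set (GLit L)) (hE : ∀ b, (E b).Countable)
    (h : ∀ b s t, (false, s, t) ∈ E b → ¬ SplitCongr E b s t) :
    ∃ (M : Type) (str : L.Structure M), Nonempty M ∧ ∀ b, ∀ l ∈ E b, LitHolds M str l := by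
  classical
  let mk : Bool → L.Term Empty → Quotient (amalgamSetoid E) := fun b t => Quotient.mk _ (b, t)
  have hcount : (⋃ b, mk b '' termsOf (E b)).Countable :=
    Set.countable_iUnion fun b => (countable_termsOf (hE b)).image _
  obtain ⟨e, he⟩ := Set.countable_iff_exists_injOn.1 hcount
  have inj : ∀ {b c s t}, s ∈ termsOf (E b) → t ∈ termsOf (E c) → e (mk b s) = e (mk c t) →
      amalgamSetoid E (b, s) (c, t) := fun {b c s t} hs ht hst =>
    Quotient.exact (he (Set.mem_iUnion.2 ⟨b, s, hs, rfl⟩) (Set.mem_iUnion.2 ⟨c, t, ht, rfl⟩) hst)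
  let Graph : ∀ {k : ℕ}, L.Functions k → (Fin k → ℕ) → ℕ → Prop := fun {k} f d n =>
    ∃ b ts, Term.func f ts ∈ termsOf (E b) ∧ (∀ i, e (mk b (ts i)) = d i) ∧
      e (mk b (Term.func f ts)) = n
  have graph_unique : ∀ {k : ℕ} {f : L.Functions k} {d m n}, Graph f d m → Graph f d n → m = n := by
    rintro k f d m n ⟨b, ss, hs, hsd, rfl⟩ ⟨c, ts, ht, htd, rfl⟩
    refine congrArg e (Quotient.sound (amalgamSetoid_func
      (mem_symbolsOf_of_mem_termsOf hs (.head f ss))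
      (mem_symbolsOf_of_mem_termsOf ht (.head f ts)) fun i => ?_))
    exact inj (arg_mem_termsOf hs i) (arg_mem_termsOf ht i) ((hsd i).trans (htd i).symm)
  let str : L.Structure ℕ :=
    { funMap := fun f d => if h : ∃ n, Graph f d n then h.choose else 0
      RelMap := fun _ _ => False }
  have hval : ∀ b t, t ∈ termsOf (E b) → gval ℕ str t = e (mk b t) := by
    intro b t ht
    induction t with
    | var x => exact x.elim
    | func f ts ih =>
      rw [gval_func, funext fun i => ih i (arg_mem_termsOf ht i)]
      have hg : Graph f (fun i => e (mk b (ts i))) (e (mk b (Term.func f ts))) :=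
        ⟨b, ts, ht, fun _ => rfl, rfl⟩
      have hex : ∃ n, Graph f (fun i => e (mk b (ts i))) n := ⟨_, hg⟩
      exact (dif_pos hex).trans (graph_unique hex.choose_spec hg)
  refine ⟨ℕ, str, ⟨0⟩, ?_⟩
  rintro b ⟨_ | _, s, t⟩ hl
  all_goals
    have hs : s ∈ termsOf (E b) := mem_termsOf.2 ⟨_, hl, Or.inl (self_mem_subterms _)⟩
    have ht : t ∈ termsOf (E b) := mem_termsOf.2 ⟨_, hl, Or.inr (self_mem_subterms _)⟩
    simp only [LitHolds, hval b s hs, hval b t ht]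
  · simpa using fun hst => h b s t hl (amalgamSetoid_same.1 (inj hs ht hst))
  · simpa using congrArg e (Quotient.sound (amalgamSetoid_same.2 (.base hl)))

/-! ### Partial interpolants -/

/-- `φ` follows from `E b` together with finitely many equations `P` between shared terms, which
in turn follow from `E false` and finitely many shared Horn clauses `I` entailed by `E true`. -/
def HasInterpolant (E : Bool → Set (GLit L)) (b : Bool)
    (φ : ∀ M : Type, L.Structure M → Prop) : Prop :=
  ∃ (I : List (HornClause L)) (P : List (L.Term Empty × L.Term Empty)),
    (∀ c ∈ I, ∀ g ∈ ClauseSymbols c, ∀ b', g ∈ SymbolsOf (E b')) ∧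
    (∀ (M : Type) (str : L.Structure M), (∀ l ∈ E true, LitHolds M str l) →
      ∀ c ∈ I, HornHolds M str c) ∧
    (∀ p ∈ P, IsShared E p.1 ∧ IsShared E p.2) ∧
    (∀ (M : Type) (str : L.Structure M), (∀ l ∈ E false, LitHolds M str l) →
      (∀ c ∈ I, HornHolds M str c) → ∀ p ∈ P, gval M str p.1 = gval M str p.2) ∧
    ∀ (M : Type) (str : L.Structure M), (∀ l ∈ E b, LitHolds M str l) →
      (∀ p ∈ P, gval M str p.1 = gval M str p.2) → φ M str

theorem HasInterpolant.of_entails {E : Bool → Set (GLit L)} {b : Bool}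
    {φ : ∀ M : Type, L.Structure M → Prop}
    (h : ∀ M str, (∀ l ∈ E b, LitHolds M str l) → φ M str) : HasInterpolant E b φ :=
  ⟨[], [], by simp, by simp, by simp, by simp, fun M str hM _ => h M str hM⟩

theorem HasInterpolant.mono {E : Bool → Set (GLit L)} {b : Bool}
    {φ ψ : ∀ M : Type, L.Structure M → Prop} (hφ : HasInterpolant E b φ)
    (h : ∀ M str, (∀ l ∈ E b, LitHolds M str l) → φ M str → ψ M str) : HasInterpolant E b ψ := by
  obtain ⟨I, P, h₁, h₂, h₃, h₄, h₅⟩ := hφ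
  exact ⟨I, P, h₁, h₂, h₃, h₄, fun M str hM hP => h M str hM (h₅ M str hM hP)⟩

theorem HasInterpolant.all {E : Bool → Set (GLit L)} {b : Bool} {ι : Type*} [Fintype ι]
    {φ : ι → ∀ M : Type, L.Structure M → Prop} (hφ : ∀ i, HasInterpolant E b (φ i)) :
    HasInterpolant E b fun M str => ∀ i, φ i M str := by
  choose I P h₁ h₂ h₃ h₄ h₅ using hφ
  refine ⟨Finset.univ.toList.flatMap I, Finset.univ.toList.flatMap P, ?_, ?_, ?_, ?_, ?_⟩
  all_goals simp only [List.mem_flatMap, Finset.mem_toList, Finset.mem_univ, true_and]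
  · rintro c ⟨i, hi⟩
    exact h₁ i c hi
  · rintro M str hM c ⟨i, hi⟩
    exact h₂ i M str hM c hi
  · rintro p ⟨i, hi⟩
    exact h₃ i p hi
  · rintro M str hM hI p ⟨i, hi⟩
    exact h₄ i M str hM (fun c hc => hI c ⟨i, hc⟩) p hi
  · intro M str hM hP i
    exact h₅ i M str hM fun p hp => hP p ⟨i, hp⟩

theorem clause_shared {E : Bool → Set (GLit L)} {P : List (L.Term Empty × L.Term Empty)}
    {q : Option (L.Term Empty × L.Term Empty)} (hP : ∀ p ∈ P, IsShared E p.1 ∧ IsShared E p.2)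
    (hq : ∀ p, q = some p → IsShared E p.1 ∧ IsShared E p.2) :
    ∀ g ∈ ClauseSymbols (P, q), ∀ b, g ∈ SymbolsOf (E b) := by
  rintro g (⟨p, hp, hg⟩ | ⟨p, hp, hg⟩)
  · exact hg.elim ((hP p hp).1 g) ((hP p hp).2 g)
  · exact hg.elim ((hq p hp).1 g) ((hq p hp).2 g)

theorem HasInterpolant.transfer {E : Bool → Set (GLit L)} {b : Bool} {s t : L.Term Empty}
    (b' : Bool) (h : HasInterpolant E b fun M str => gval M str s = gval M str t)
    (hs : IsShared E s) (ht : IsShared E t) :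
    HasInterpolant E b' fun M str => gval M str s = gval M str t := by
  obtain ⟨I, P, h₁, h₂, h₃, h₄, h₅⟩ := h
  cases b with
  | false =>
    refine ⟨I, [(s, t)], h₁, h₂, by simp [hs, ht], ?_, by simp⟩
    intro M str hM hI
    simpa using h₅ M str hM (h₄ M str hM hI)
  | true =>
    refine ⟨(P, some (s, t)) :: I, [(s, t)], ?_, ?_, by simp [hs, ht], ?_, by simp⟩
    · refine List.forall_mem_cons.2 ⟨clause_shared h₃ ?_, h₁⟩
      rintro _ ⟨⟩
      exact ⟨hs, ht⟩
    · exact fun M str hM => List.forall_mem_cons.2 ⟨h₅ M str hM, h₂ M str hM⟩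
    · intro M str hM hI
      obtain ⟨hc, hI⟩ := List.forall_mem_cons.1 hI
      simpa using hc (h₄ M str hM hI)

theorem SplitCongr.hasInterpolant {E : Bool → Set (GLit L)} {b : Bool} {s t : L.Term Empty}
    (h : SplitCongr E b s t) :
    HasInterpolant E b fun M str => gval M str s = gval M str t := by
  induction h with
  | base h => exact .of_entails fun M str hM => by simpa [LitHolds] using hM _ h
  | transfer b' _ hs ht ih => exact ih.transfer b' hs ht
  | refl t => exact .of_entails fun _ _ _ => rfl
  | symm _ ih => exact ih.mono fun _ _ _ h => h.symm
  | @trans b s t r _ _ ih₁ ih₂ =>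
    have := HasInterpolant.all (E := E) (b := b)
      (φ := fun (i : Bool) M str => cond i (gval M str s = gval M str t)
        (gval M str t = gval M str r)) (by rintro (_ | _) <;> assumption)
    exact this.mono fun _ _ _ h => (h true).trans (h false)
  | congr f _ ih =>
    exact (HasInterpolant.all ih).mono fun M str _ h => by
      rw [gval_func, gval_func, funext h]

/-- A refutation of either part yields a Horn interpolant. -/
theorem HasInterpolant.exists_interpolant {E : Bool → Set (GLit L)} {b : Bool}
    (h : HasInterpolant E b fun _ _ => False) :
    ∃ I : List (HornClause L),
      (∀ c ∈ I, ∀ g ∈ ClauseSymbols c, ∀ b, g ∈ SymbolsOf (E b)) ∧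
      (∀ (M : Type) (str : L.Structure M), (∀ l ∈ E true, LitHolds M str l) →
        ∀ c ∈ I, HornHolds M str c) ∧
      ∀ (M : Type) (str : L.Structure M), (∀ l ∈ E false, LitHolds M str l) →
        ¬ ∀ c ∈ I, HornHolds M str c := by
  obtain ⟨I, P, h₁, h₂, h₃, h₄, h₅⟩ := h
  cases b with
  | false => exact ⟨I, h₁, h₂, fun M str hM hI => h₅ M str hM (h₄ M str hM hI)⟩
  | true =>
    refine ⟨(P, none) :: I, List.forall_mem_cons.2 ⟨clause_shared h₃ (by simp), h₁⟩,
      fun M str hM => List.forall_mem_cons.2 ⟨h₅ M str hM, h₂ M str hM⟩, fun M str hM hI => ?_⟩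
    obtain ⟨hc, hI⟩ := List.forall_mem_cons.1 hI
    exact hc (h₄ M str hM hI)

end

/-- If `A` and `B` are disjoint finite sets of ground equality
literals whose union is unsatisfiable, then there is an interpolant `I` for `A, B`
which is a conjunction of ground Horn clauses whose atoms are equations: every
function symbol of `I` occurs both in `A` and in `B`, `A ⊨ I`, and `B ∪ {I}` is
unsatisfiable. -/
theorem euf_literal_interpolation
    {L : FirstOrder.Language.{u, v}} (A B : Set (GLit L))
    (hdisj : Disjoint A B) (hAfin : A.Finite) (hBfin : B.Finite)
    (hunsat : ¬ ∃ (M : Type) (str : L.Structure M), Nonempty M ∧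
      ∀ l ∈ A ∪ B, LitHolds M str l) :
    ∃ I : List (HornClause L),
      (∀ c ∈ I, ∀ g ∈ ClauseSymbols c, g ∈ SymbolsOf A ∧ g ∈ SymbolsOf B) ∧
      (∀ (M : Type) (str : L.Structure M), Nonempty M →
        (∀ l ∈ A, LitHolds M str l) → ∀ c ∈ I, HornHolds M str c) ∧
      (¬ ∃ (M : Type) (str : L.Structure M), Nonempty M ∧
        (∀ l ∈ B, LitHolds M str l) ∧ ∀ c ∈ I, HornHolds M str c) := by
  let E : Bool → Set (GLit L) := fun b => cond b A B
  obtain ⟨b, s, t, hl, hst⟩ : ∃ b s t, (false, s, t) ∈ E b ∧ SplitCongr E b s t := by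
    by_contra! hcon
    obtain ⟨M, str, hM, hE⟩ := exists_model_of_splitCongr E
      (Bool.forall_bool.2 ⟨hBfin.countable, hAfin.countable⟩) hcon
    exact hunsat ⟨M, str, hM, fun l hl => hl.elim (hE true l) (hE false l)⟩
  have hfalse : HasInterpolant E b fun _ _ => False :=
    hst.hasInterpolant.mono fun M str hM h => by
      have := hM _ hl
      simp [LitHolds, h] at this
  obtain ⟨I, h₁, h₂, h₃⟩ := hfalse.exists_interpolant
  exact ⟨I, fun c hc g hg => ⟨h₁ c hc g hg true, h₁ c hc g hg false⟩,
    fun M str _ hM => h₂ M str hM, fun ⟨M, str, _, hM, hI⟩ => h₃ M str hM hI⟩
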